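/- arXiv:2010.12229 — 3 statements merged into one kernel-verified Lean document; each statement's English description precedes it below -/
import Mathlib

section
/- Let V be a finite set of N ≥ 2 vertices and let d be a Euclidean delay function on V (symmetric and satisfying the triangle inequality, with nonnegative values). Let τ* be the minimum, over all strongly connected spanning subdigraphs G of the complete digraph on V, of the cycle time τ(G), and let H* be a Hamiltonian cycle of minimum total delay. If Ĥ is any Hamiltonian cycle whose total delay satisfies d(Ĥ) ≤ (3/2)·d(H*) (the guarantee achieved by Christofides' algorithm), then the cycle time of Ĥ satisfies d(Ĥ)/N ≤ 3N·τ*. -/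
/-- The list of cyclically-consecutive ordered pairs of a list
`[i₁, …, iₚ]`, namely `[(i₁,i₂), (i₂,i₃), …, (iₚ,i₁)]`. -/
def cyclicPairs {V : Type*} (l : List V) : List (V × V) := l.zip (l.rotate 1)

/-- `c` is an elementary circuit of the digraph with arc relation `A`:
a list of at least two pairwise-distinct vertices whose cyclically
consecutive pairs are all arcs of `A`. -/
def IsElemCircuit {V : Type*} (A : V → V → Prop) (c : List V) : Prop :=
  2 ≤ c.length ∧ c.Nodup ∧ ∀ p ∈ cyclicPairs c, A p.1 p.2

/-- The total delay `d(γ)` of a circuit, i.e. the sum of the delays of its arcs. -/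
def circuitDelay {V : Type*} (d : V → V → ℝ) (c : List V) : ℝ :=
  ((cyclicPairs c).map fun p => d p.1 p.2).sum

/-- The cycle time of a digraph: the maximum over elementary circuits γ of d(γ)/|γ|. -/
noncomputable def cycleTime {V : Type*} (A : V → V → Prop) (d : V → V → ℝ) : ℝ :=
  sSup {x : ℝ | ∃ c : List V, IsElemCircuit A c ∧ x = circuitDelay d c / (c.length : ℝ)}

/-- A digraph is strongly connected if every vertex can reach every other vertex. -/
def StronglyConnected {V : Type*} (A : V → V → Prop) : Prop :=
  ∀ i j : V, Relation.ReflTransGen A i j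

/-- A Hamiltonian cycle of the complete digraph on a finite vertex type:
a list of pairwise-distinct vertices containing every vertex. -/
def IsHamCycle {V : Type*} (c : List V) : Prop := c.Nodup ∧ ∀ v : V, v ∈ c

theorem cyclicPairs_cons {V : Type*} (a : V) (t : List V) :
    cyclicPairs (a :: t) = (a :: t).zip (t ++ [a]) := by
  simp [cyclicPairs]

theorem circuitDelay_rotate {V : Type*} (d : V → V → ℝ) (l : List V) (n : ℕ) :
    circuitDelay d (l.rotate n) = circuitDelay d l := by
  have h : cyclicPairs (l.rotate n) = (cyclicPairs l).rotate n := by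
    unfold cyclicPairs
    rw [List.rotate_rotate, Nat.add_comm, ← List.rotate_rotate]
    exact (List.zipWith_rotate_distrib _ _ _ _ (by simp)).symm
  unfold circuitDelay
  rw [h]
  exact ((List.rotate_perm _ _).map _).sum_eq

/-- Inserting a vertex `v` right after the head `u` of a circuit lengthens it by at most
`2 * d u v`. -/
theorem circuitDelay_insert_le {V : Type*} {d : V → V → ℝ}
    (hsymm : ∀ i j : V, d i j = d j i)
    (htri : ∀ i j k : V, i ≠ j → i ≠ k → j ≠ k → d i j ≤ d i k + d k j)
    {u v w : V} {t : List V} (huv : u ≠ v) (huw : u ≠ w) (hvw : v ≠ w) :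
    circuitDelay d (u :: v :: w :: t) ≤ circuitDelay d (u :: w :: t) + 2 * d u v := by
  have h := htri v w u hvw huv.symm huw.symm
  rw [hsymm v u] at h
  simp only [circuitDelay, cyclicPairs_cons, List.cons_append, List.zip_cons_cons, List.map_cons,
    List.sum_cons]
  linarith

theorem exists_nodup_isChain_of_reflTransGen {V : Type*} {A : V → V → Prop} {a b : V}
    (h : Relation.ReflTransGen A a b) :
    ∃ t : List V, (a :: t).Nodup ∧ (a :: t).IsChain A ∧ (a :: t).getLast? = some b := by
  induction h using Relation.ReflTransGen.head_induction_on with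
  | refl => exact ⟨[], by simp⟩
  | @head a c hac _ ih =>
    obtain ⟨t, hnd, hch, hlast⟩ := ih
    by_cases ha : a ∈ c :: t
    · obtain ⟨s, r, hsr⟩ := List.append_of_mem ha
      rw [hsr] at hnd hch hlast
      refine ⟨r, hnd.of_append_right, hch.right_of_append, ?_⟩
      simpa [List.getLast?_append] using hlast
    · refine ⟨c :: t, List.nodup_cons.2 ⟨ha, hnd⟩, List.isChain_cons_cons.2 ⟨hac, hch⟩, ?_⟩
      simpa using hlast

theorem rel_of_mem_zip_of_isChain {V : Type*} {A : V → V → Prop} {a b x : V} {t : List V}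
    (hch : (a :: t).IsChain A) (hlast : (a :: t).getLast? = some b) (hbx : A b x) :
    (∀ p ∈ (a :: t).zip (t ++ [x]), A p.1 p.2) ∧ (b, x) ∈ (a :: t).zip (t ++ [x]) := by
  induction t generalizing a with
  | nil =>
    obtain rfl : a = b := by simpa using hlast
    simpa using hbx
  | cons c t ih =>
    rw [List.isChain_cons_cons] at hch
    obtain ⟨h₁, h₂⟩ := ih hch.2 (by simpa using hlast)
    rw [List.cons_append, List.zip_cons_cons]
    refine ⟨?_, List.mem_cons_of_mem _ h₂⟩
    intro p hp
    rcases List.mem_cons.1 hp with rfl | hp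
    · exact hch.1
    · exact h₁ p hp

theorem StronglyConnected.exists_isElemCircuit {V : Type*} {A : V → V → Prop}
    (hA : StronglyConnected A) {i j : V} (hij : i ≠ j) (h : A i j) :
    ∃ c : List V, IsElemCircuit A c ∧ (i, j) ∈ cyclicPairs c := by
  obtain ⟨t, hnd, hch, hlast⟩ := exists_nodup_isChain_of_reflTransGen (hA j i)
  obtain ⟨h₁, h₂⟩ := rel_of_mem_zip_of_isChain hch hlast h
  rw [← cyclicPairs_cons] at h₁ h₂
  refine ⟨j :: t, ⟨?_, hnd, h₁⟩, h₂⟩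
  cases t with
  | nil => exact absurd (by simpa using hlast) hij.symm
  | cons => simp

theorem circuitDelay_div_length_le_cycleTime {V : Type*} [Fintype V] {A : V → V → Prop}
    (d : V → V → ℝ) {c : List V} (hc : IsElemCircuit A c) :
    circuitDelay d c / (c.length : ℝ) ≤ cycleTime A d := by
  refine le_csSup (Set.Finite.bddAbove ?_) ⟨c, hc, rfl⟩
  refine ((List.finite_length_le V (Fintype.card V)).image
    fun c => circuitDelay d c / (c.length : ℝ)).subset ?_
  rintro _ ⟨c, hc, rfl⟩
  exact ⟨c, hc.2.1.length_le_card, rfl⟩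

theorem StronglyConnected.delay_le {V : Type*} [Fintype V] {A : V → V → Prop} {d : V → V → ℝ}
    (hnonneg : ∀ i j : V, i ≠ j → 0 ≤ d i j) (hirr : ∀ i j, A i j → i ≠ j)
    (hA : StronglyConnected A) {i j : V} (h : A i j) :
    d i j ≤ Fintype.card V * cycleTime A d := by
  obtain ⟨c, hc, hmem⟩ := hA.exists_isElemCircuit (hirr i j h) h
  have hpos : (0 : ℝ) < c.length := by
    have := hc.1
    exact_mod_cast (by omega : 0 < c.length)
  have hterms : ∀ x ∈ (cyclicPairs c).map (fun p => d p.1 p.2), 0 ≤ x := by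
    intro x hx
    obtain ⟨p, hp, rfl⟩ := List.mem_map.1 hx
    exact hnonneg _ _ (hirr _ _ (hc.2.2 p hp))
  have hle : d i j ≤ circuitDelay d c :=
    List.single_le_sum hterms _ (List.mem_map.2 ⟨(i, j), hmem, rfl⟩)
  have hτ := circuitDelay_div_length_le_cycleTime d hc
  have hτ₀ : 0 ≤ cycleTime A d :=
    (div_nonneg ((hnonneg i j (hirr i j h)).trans hle) hpos.le).trans hτ
  rw [div_le_iff₀ hpos] at hτ
  have hlen : (c.length : ℝ) ≤ Fintype.card V := by exact_mod_cast hc.2.1.length_le_card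
  nlinarith [mul_le_mul_of_nonneg_right hlen hτ₀]

theorem StronglyConnected.exists_arc_of_notMem {V : Type*} {A : V → V → Prop}
    (hA : StronglyConnected A) {S : Set V} {a b : V} (ha : a ∈ S) (hb : b ∉ S) :
    ∃ u ∈ S, ∃ v ∉ S, A u v := by
  by_contra! hcon
  refine hb ?_
  clear hb
  induction hA a b with
  | refl => exact ha
  | tail _ hbc ih =>
    by_contra hc
    exact hcon _ ih _ hc hbc

/-- If every arc of a strongly connected digraph has delay at most `M`, then for every
`2 ≤ k ≤ N` there is a circuit of the complete digraph on `k` vertices with total delay at most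
`2 * (k - 1) * M`. -/
theorem StronglyConnected.exists_nodup_circuitDelay_le {V : Type*} [Fintype V]
    {A : V → V → Prop} {d : V → V → ℝ} {M : ℝ}
    (hsymm : ∀ i j : V, d i j = d j i)
    (htri : ∀ i j k : V, i ≠ j → i ≠ k → j ≠ k → d i j ≤ d i k + d k j)
    (hirr : ∀ i j, A i j → i ≠ j) (hA : StronglyConnected A)
    (hM : ∀ i j, A i j → d i j ≤ M) {k : ℕ} (hk : 2 ≤ k) (hkN : k ≤ Fintype.card V) :
    ∃ l : List V, l.Nodup ∧ l.length = k ∧ circuitDelay d l ≤ 2 * ((k : ℝ) - 1) * M := by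
  induction k, hk using Nat.le_induction with
  | base =>
    obtain ⟨a, b, hab⟩ := Fintype.one_lt_card_iff.1 hkN
    obtain ⟨u, -, v, -, huv⟩ :=
      hA.exists_arc_of_notMem (S := {a}) rfl (fun h : b = a => hab h.symm)
    refine ⟨[u, v], by simpa using hirr u v huv, rfl, ?_⟩
    have h := hM u v huv
    simp only [circuitDelay, cyclicPairs_cons, List.cons_append, List.nil_append,
      List.zip_cons_cons, List.zip_nil_left, List.map_cons, List.map_nil, List.sum_cons,
      List.sum_nil, hsymm v u]
    push_cast
    linarith
  | succ k hk ih =>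
    obtain ⟨l, hnd, hlen, hl⟩ := ih (by omega)
    obtain ⟨b, hb⟩ : ∃ b, b ∉ l := by
      classical
      by_contra! hall
      have h₁ : l.toFinset = Finset.univ := by
        ext x
        simpa using hall x
      have h₂ := List.toFinset_card_of_nodup hnd
      rw [h₁, Finset.card_univ] at h₂
      omega
    obtain ⟨a, ha⟩ := List.exists_mem_of_length_pos (by omega : 0 < l.length)
    obtain ⟨u, hu, v, hv, huv⟩ := hA.exists_arc_of_notMem (S := {x | x ∈ l}) ha hb
    obtain ⟨s, r, rfl⟩ := List.append_of_mem hu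
    have hrot : (s ++ u :: r).rotate s.length = u :: (r ++ s) := by
      rw [List.rotate_append_length_eq, List.cons_append]
    rw [← circuitDelay_rotate d _ s.length, hrot] at hl
    rw [← List.nodup_rotate (n := s.length), hrot] at hnd
    rw [← List.length_rotate _ s.length, hrot] at hlen
    have hv' : v ∉ u :: (r ++ s) := by
      rw [← hrot, List.mem_rotate]
      exact hv
    generalize r ++ s = t at *
    cases t with
    | nil => simp at hlen; omega
    | cons w t =>
      simp only [List.nodup_cons, List.mem_cons, not_or] at hnd hv'
      refine ⟨u :: v :: w :: t, ?_, by simpa using hlen, ?_⟩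
      · simp only [List.nodup_cons, List.mem_cons, not_or]
        exact ⟨⟨hirr u v huv, hnd.1⟩, hv'.2, hnd.2⟩
      · have h₁ := circuitDelay_insert_le hsymm htri (t := t) (hirr u v huv) hnd.1.1 hv'.2.1
        have h₂ := hM u v huv
        push_cast
        linarith

/-- **Prop. 3.** For a Euclidean delay function on `N ≥ 2` vertices, any
Hamiltonian cycle `Ĥ` whose total delay is within a factor `3/2` of the optimal tour
(the Christofides guarantee) has cycle time `d(Ĥ)/N ≤ 3N·τ*`, where `τ*` is the minimum
cycle time over strongly connected spanning subdigraphs of the complete digraph. -/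
theorem christofides_three_N_approx {V : Type*} [Fintype V]
    (hN : 2 ≤ Fintype.card V)
    (d : V → V → ℝ)
    (hnonneg : ∀ i j : V, i ≠ j → 0 ≤ d i j)
    (hsymm : ∀ i j : V, d i j = d j i)
    (htri : ∀ i j k : V, i ≠ j → i ≠ k → j ≠ k → d i j ≤ d i k + d k j)
    (Hstar : List V) (hHamStar : IsHamCycle Hstar)
    (hopt : ∀ c : List V, IsHamCycle c → circuitDelay d Hstar ≤ circuitDelay d c)
    (Hhat : List V) (hHamHat : IsHamCycle Hhat)
    (happrox : circuitDelay d Hhat ≤ (3 / 2) * circuitDelay d Hstar) :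
    circuitDelay d Hhat / (Fintype.card V : ℝ) ≤
      3 * (Fintype.card V : ℝ) *
        sInf {x : ℝ | ∃ A : V → V → Prop, (∀ i j, A i j → i ≠ j) ∧
          StronglyConnected A ∧ x = cycleTime A d} := by
  have hNpos : (0 : ℝ) < Fintype.card V := by exact_mod_cast (by omega : 0 < Fintype.card V)
  rw [← div_le_iff₀' (by positivity)]
  refine le_csInf ?_ ?_
  · refine ⟨_, fun i j => i ≠ j, fun _ _ h => h, fun i j => ?_, rfl⟩
    by_cases h : i = j
    · exact h ▸ .refl
    · exact .single h
  rintro _ ⟨A, hirr, hA, rfl⟩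
  have hM : ∀ i j, A i j → d i j ≤ Fintype.card V * cycleTime A d :=
    fun i j h => hA.delay_le hnonneg hirr h
  obtain ⟨l, hnd, hlen, hl⟩ :=
    hA.exists_nodup_circuitDelay_le hsymm htri hirr hM hN le_rfl
  have hham : IsHamCycle l := by
    classical
    refine ⟨hnd, fun v => ?_⟩
    have h : l.toFinset = Finset.univ := by
      rw [← Finset.card_eq_iff_eq_univ, List.toFinset_card_of_nodup hnd, hlen]
    simpa [h] using List.mem_toFinset (a := v) (l := l)
  have hτ : 0 ≤ Fintype.card V * cycleTime A d := by
    obtain ⟨a, b, hab⟩ := Fintype.one_lt_card_iff.1 hN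
    obtain ⟨u, -, v, -, huv⟩ :=
      hA.exists_arc_of_notMem (S := {a}) rfl (fun h : b = a => hab h.symm)
    exact (hnonneg u v (hirr u v huv)).trans (hM u v huv)
  have hstar := hopt l hham
  rw [div_div, div_le_iff₀ (by positivity)]
  linarith
end

section
/- Let G = (V, E) be a finite connected undirected graph. In the node-capacitated setting (constants s ≥ 0 and M ≥ 0, node functions T_c : V → ℝ≥0 and a : V → ℝ≥0, latencies l : V × V → ℝ≥0, with arc delay d_o^H(i,j) = s·T_c(i) + l(i,j) + deg_H(i)·a(i) in an undirected subgraph H, symmetrized weight w({i,j}) = [s·(T_c(i)+T_c(j)) + l(i,j) + l(j,i) + a(i) + a(j)]/2, and bottleneck B(T) = max of w over the edges of T), the minimum bottleneck over spanning trees lower-bounds every overlay's cycle time: for every connected spanning subgraph H of G, min_{T' spanning tree of G} B(T') ≤ τ(H), where τ(H) is the cycle time of the bidirected overlay on H with arc delays d_o^H. -/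
theorem circuitDelay_nonneg {V : Type*} {d : V → V → ℝ} (hd : ∀ i j, 0 ≤ d i j)
    (c : List V) : 0 ≤ circuitDelay d c :=
  List.sum_nonneg (by simpa using fun x i j _ h => h ▸ hd i j)

theorem cycleTime_nonneg {V : Type*} (A : V → V → Prop) {d : V → V → ℝ}
    (hd : ∀ i j, 0 ≤ d i j) : 0 ≤ cycleTime A d := by
  apply Real.sSup_nonneg
  rintro x ⟨c, -, rfl⟩
  exact div_nonneg (circuitDelay_nonneg hd c) (Nat.cast_nonneg _)

/-- The circuit means of a finite digraph are bounded above, so its cycle time is a genuine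
supremum. -/
theorem bddAbove_circuitMeans {V : Type*} [Finite V] (A : V → V → Prop) (d : V → V → ℝ) :
    BddAbove {x : ℝ | ∃ c : List V, IsElemCircuit A c ∧
      x = circuitDelay d c / (c.length : ℝ)} := by
  have := Fintype.ofFinite V
  have hfin : {c : List V | c.Nodup}.Finite :=
    (List.finite_length_le V (Fintype.card V)).subset fun c hc => hc.length_le_card
  refine (hfin.image fun c => circuitDelay d c / (c.length : ℝ)).bddAbove.mono ?_
  rintro x ⟨c, hc, rfl⟩
  exact ⟨c, hc.2.1, rfl⟩

/-- The mean delay of a two-arc circuit is at most the cycle time. -/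
theorem half_add_le_cycleTime {V : Type*} [Finite V] {A : V → V → Prop} (d : V → V → ℝ)
    {i j : V} (hne : i ≠ j) (hij : A i j) (hji : A j i) :
    (d i j + d j i) / 2 ≤ cycleTime A d := by
  refine le_csSup (bddAbove_circuitMeans A d) ⟨[i, j], ⟨by simp, by simpa using hne, ?_⟩, ?_⟩
  · simp [cyclicPairs, hij, hji]
  · simp [circuitDelay, cyclicPairs]

/-- **Lemma 3.** In the node-capacitated setting, the minimum bottleneck
over spanning trees of `G` (with respect to the symmetrized weights
`w({i,j}) = [s(T_c(i)+T_c(j)) + l(i,j) + l(j,i) + a(i) + a(j)]/2`) lower-bounds the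
cycle time of the bidirected overlay on every connected spanning subgraph `H` of `G`,
where the delay of arc `(i,j)` in `H` is `s·T_c(i) + l(i,j) + deg_H(i)·a(i)`. -/
theorem min_bottleneck_le_cycleTime {V : Type*} [Fintype V]
    (G : SimpleGraph V) (hG : G.Connected)
    (s : ℝ) (hs : 0 ≤ s)
    (Tc a : V → ℝ) (hTc : ∀ i, 0 ≤ Tc i) (ha : ∀ i, 0 ≤ a i)
    (l : V → V → ℝ) (hl : ∀ i j, 0 ≤ l i j)
    (H : SimpleGraph V) (hHG : H ≤ G) (hH : H.Connected) :
    sInf {b : ℝ | ∃ T : SimpleGraph V, T ≤ G ∧ T.IsTree ∧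
        b = sSup {x : ℝ | ∃ i j : V, T.Adj i j ∧
          x = (s * (Tc i + Tc j) + l i j + l j i + a i + a j) / 2}} ≤
      cycleTime H.Adj
        (fun i j => s * Tc i + l i j + ((H.neighborSet i).ncard : ℝ) * a i) := by
  set d : V → V → ℝ :=
    fun i j => s * Tc i + l i j + ((H.neighborSet i).ncard : ℝ) * a i with hd
  have hd0 : ∀ i j, 0 ≤ d i j := fun i j =>
    add_nonneg (add_nonneg (mul_nonneg hs (hTc i)) (hl i j))
      (mul_nonneg (Nat.cast_nonneg _) (ha i))
  have hdeg : ∀ {i j}, H.Adj i j → a i ≤ ((H.neighborSet i).ncard : ℝ) * a i := by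
    intro i j hij
    have hpos : 0 < (H.neighborSet i).ncard := (Set.ncard_pos (Set.toFinite _)).2 ⟨j, hij⟩
    exact le_mul_of_one_le_left (ha i) (by exact_mod_cast hpos)
  obtain ⟨T, hTH, hT⟩ := hH.exists_isTree_le
  refine csInf_le_of_le ?_ ⟨T, hTH.trans hHG, hT, rfl⟩ ?_
  · refine ⟨0, ?_⟩
    rintro b ⟨T', -, -, rfl⟩
    apply Real.sSup_nonneg
    rintro x ⟨i, j, -, rfl⟩
    have := mul_nonneg hs (add_nonneg (hTc i) (hTc j))
    linarith [hl i j, hl j i, ha i, ha j]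
  · refine Real.sSup_le ?_ (cycleTime_nonneg _ hd0)
    rintro x ⟨i, j, hij, rfl⟩
    have hadj := hTH hij
    refine le_trans ?_ (half_add_le_cycleTime d hadj.ne hadj hadj.symm)
    simp only [hd]
    linarith [hdeg hadj, hdeg hadj.symm]
end

section
/- Let N ≥ 2, let V = {1, …, 2N}, and define d(i,j) = 0 if both i ≤ N and j ≤ N, and d(i,j) = 1 otherwise, for all distinct i, j. Then: (i) d is symmetric and satisfies the triangle inequality (d is Euclidean); (ii) every Hamiltonian cycle H of the complete digraph on V has total delay d(H) ≥ N, hence cycle time d(H)/(2N) ≥ 1/2; (iii) the spanning subdigraph with arcs (i, i+1) for 1 ≤ i ≤ N−1 and arcs (N, K) and (K, 1) for each N+1 ≤ K ≤ 2N is strongly connected and has cycle time exactly 2/(N+1). Consequently every Hamiltonian cycle H satisfies (cycle time of H) ≥ ((N+1)/4)·τ*, where τ* is the minimum cycle time over all strongly connected spanning subdigraphs of the complete digraph on V. -/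
/-- The directed overlay of the Ω(N) example: arcs `i → i+1` along the first `N`
vertices, plus arcs `(N-1) → K` and `K → 0` for every vertex `K` of the second half
(0-indexed version of arcs `(i,i+1)` for `1 ≤ i ≤ N-1` and `(N,K)`, `(K,1)` for
`N+1 ≤ K ≤ 2N`). -/
def ringStarRel (N : ℕ) : Fin (2 * N) → Fin (2 * N) → Prop := fun i j =>
  (j.val = i.val + 1 ∧ j.val < N) ∨ (i.val = N - 1 ∧ N ≤ j.val) ∨ (N ≤ i.val ∧ j.val = 0)

theorem cyclicPairs_map_fst {V : Type*} (c : List V) : (cyclicPairs c).map Prod.fst = c :=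
  List.map_fst_zip (by simp)

theorem cyclicPairs_map_snd {V : Type*} (c : List V) :
    (cyclicPairs c).map Prod.snd = c.rotate 1 :=
  List.map_snd_zip (by simp)

theorem length_cyclicPairs {V : Type*} (c : List V) : (cyclicPairs c).length = c.length := by
  simp [cyclicPairs]

theorem sum_cyclicPairs_fst {V : Type*} (f : V → ℝ) (c : List V) :
    ((cyclicPairs c).map fun p => f p.1).sum = (c.map f).sum := by
  conv_rhs => rw [← cyclicPairs_map_fst c, List.map_map]
  rfl

theorem sum_cyclicPairs_snd {V : Type*} (f : V → ℝ) (c : List V) :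
    ((cyclicPairs c).map fun p => f p.2).sum = (c.map f).sum := by
  rw [← ((c.rotate_perm 1).map f).sum_eq, ← cyclicPairs_map_snd c, List.map_map]
  rfl

/-- If the delay of every arc is a constant plus a potential difference, then the delay of a
circuit is that constant times its length. -/
theorem circuitDelay_eq_of_potential {V : Type*} {A : V → V → Prop} {d : V → V → ℝ}
    {c : List V} (φ : V → ℝ) (t : ℝ) (h : ∀ i j, A i j → d i j + φ i = t + φ j)
    (hc : ∀ p ∈ cyclicPairs c, A p.1 p.2) : circuitDelay d c = c.length * t := by
  have hsum : ((cyclicPairs c).map fun p => d p.1 p.2 + φ p.1).sum =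
      ((cyclicPairs c).map fun p => t + φ p.2).sum :=
    congrArg List.sum (List.map_congr_left fun p hp => h _ _ (hc p hp))
  rw [List.sum_map_add, List.sum_map_add, sum_cyclicPairs_fst, sum_cyclicPairs_snd] at hsum
  simpa [circuitDelay, length_cyclicPairs] using hsum

/-- If each arc costs at least a weight of its tail, a Hamiltonian cycle costs at least the
total weight. -/
theorem sum_le_circuitDelay {V : Type*} [Fintype V] {d : V → V → ℝ} (f : V → ℝ)
    (h : ∀ i j, f i ≤ d i j) {c : List V} (hc : c.Nodup) (hmem : ∀ v, v ∈ c) :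
    ∑ v, f v ≤ circuitDelay d c := by
  classical
  have huniv : c.toFinset = Finset.univ := by ext v; simp [hmem v]
  rw [← huniv, List.sum_toFinset f hc, ← sum_cyclicPairs_fst]
  exact List.sum_le_sum fun p _ => h _ _

theorem sum_second_half_indicator (N : ℕ) :
    ∑ v : Fin (2 * N), (if v.val < N then (0 : ℝ) else 1) = N := by
  rw [Fin.sum_univ_eq_sum_range (fun v => if v < N then (0 : ℝ) else 1), two_mul,
    Finset.sum_range_add]
  rw [Finset.sum_eq_zero fun i hi => if_pos (Finset.mem_range.mp hi)]
  simp

theorem ringStarRel_ne {N : ℕ} (hN : 2 ≤ N) {i j : Fin (2 * N)} (h : ringStarRel N i j) :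
    i ≠ j := by
  rintro rfl
  unfold ringStarRel at h
  omega

theorem stronglyConnected_ringStarRel {N : ℕ} (hN : 2 ≤ N) :
    StronglyConnected (ringStarRel N) := by
  have path : ∀ m k : ℕ, ∀ (hk : k + m < N),
      Relation.ReflTransGen (ringStarRel N) ⟨k, by omega⟩ ⟨k + m, by omega⟩ := by
    intro m k
    induction m with
    | zero => exact fun _ => .refl
    | succ m ih =>
      intro hk
      exact (ih (by omega)).tail (Or.inl ⟨rfl, hk⟩)
  have path' : ∀ i j : Fin (2 * N), i.val ≤ j.val → j.val < N →
      Relation.ReflTransGen (ringStarRel N) i j := by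
    intro i j hij hj
    have := path (j.val - i.val) i.val (by omega)
    simpa [Nat.add_sub_cancel' hij] using this
  let zero : Fin (2 * N) := ⟨0, by omega⟩
  let last : Fin (2 * N) := ⟨N - 1, by omega⟩
  let hub : Fin (2 * N) := ⟨N, by omega⟩
  have from_zero : ∀ j, Relation.ReflTransGen (ringStarRel N) zero j := by
    intro j
    by_cases hj : j.val < N
    · exact path' _ _ (Nat.zero_le _) hj
    · exact (path' zero last (Nat.zero_le _) (by simp only [last]; omega)).tail
        (Or.inr (Or.inl ⟨rfl, by omega⟩))
  have to_zero : ∀ i, Relation.ReflTransGen (ringStarRel N) i zero := by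
    intro i
    by_cases hi : i.val < N
    · have h₁ : Relation.ReflTransGen (ringStarRel N) i last :=
        path' _ _ (by simp only [last]; omega) (by simp only [last]; omega)
      exact (h₁.tail (c := hub) (Or.inr (Or.inl ⟨rfl, le_rfl⟩))).tail
        (Or.inr (Or.inr ⟨le_rfl, rfl⟩))
    · exact .single (Or.inr (Or.inr ⟨by omega, rfl⟩))
  exact fun i j => (to_zero i).trans (from_zero j)

theorem exists_isElemCircuit_ringStarRel {N : ℕ} (hN : 2 ≤ N) :
    ∃ c, IsElemCircuit (ringStarRel N) c := by
  refine ⟨List.ofFn fun i : Fin (N + 1) => (⟨i.val, by omega⟩ : Fin (2 * N)), ?_, ?_, ?_⟩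
  · simp only [List.length_ofFn]; omega
  · rw [List.nodup_ofFn]
    intro i j hij
    simpa [Fin.ext_iff] using hij
  · intro p hp
    obtain ⟨k, hk, rfl⟩ := List.mem_iff_getElem.mp hp
    have hk' : k < N + 1 := by simpa [cyclicPairs] using hk
    simp only [cyclicPairs, List.getElem_zip, List.getElem_ofFn, List.getElem_rotate,
      List.length_ofFn, ringStarRel]
    rcases Nat.lt_succ_iff_lt_or_eq.mp hk' with h | rfl
    · rw [Nat.mod_eq_of_lt (by omega : k + 1 < N + 1)]
      omega
    · simp

theorem circuitDelay_ringStarRel {N : ℕ} (hN : 2 ≤ N) {d : Fin (2 * N) → Fin (2 * N) → ℝ}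
    (hd : ∀ i j : Fin (2 * N), d i j = if i.val < N ∧ j.val < N then 0 else 1)
    {c : List (Fin (2 * N))} (hc : IsElemCircuit (ringStarRel N) c) :
    circuitDelay d c = c.length * (2 / ((N : ℝ) + 1)) := by
  have hpos : (N : ℝ) + 1 ≠ 0 := by positivity
  refine circuitDelay_eq_of_potential (A := ringStarRel N)
    (fun i => if i.val < N then -(2 * (i.val : ℝ)) / (N + 1) else (1 - N) / (N + 1)) _ ?_ hc.2.2
  rintro i j (⟨h₁, h₂⟩ | ⟨h₁, h₂⟩ | ⟨h₁, h₂⟩)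
  · have hi : i.val < N := by omega
    simp only [hd, hi, h₂, and_self, if_true]
    rw [h₁]
    push_cast
    field_simp
    ring
  · have hi : i.val < N := by omega
    have hj : ¬ j.val < N := by omega
    have hcast : ((i.val : ℕ) : ℝ) = N - 1 := by
      rw [h₁, Nat.cast_sub (by omega), Nat.cast_one]
    simp only [hd, hi, hj, and_false, if_true, if_false, hcast]
    field_simp
    ring
  · have hi : ¬ i.val < N := by omega
    have hj : 0 < N := by omega
    simp only [hd, hi, hj, false_and, if_true, if_false, h₂, Nat.cast_zero]
    field_simp
    ring

theorem cycleTime_ringStarRel {N : ℕ} (hN : 2 ≤ N) {d : Fin (2 * N) → Fin (2 * N) → ℝ}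
    (hd : ∀ i j : Fin (2 * N), d i j = if i.val < N ∧ j.val < N then 0 else 1) :
    cycleTime (ringStarRel N) d = 2 / ((N : ℝ) + 1) := by
  have hratio : ∀ c, IsElemCircuit (ringStarRel N) c →
      circuitDelay d c / (c.length : ℝ) = 2 / ((N : ℝ) + 1) := by
    intro c hc
    have hlen : (c.length : ℝ) ≠ 0 := by
      have := hc.1
      exact_mod_cast (by omega : c.length ≠ 0)
    rw [circuitDelay_ringStarRel hN hd hc, mul_div_cancel_left₀ _ hlen]
  obtain ⟨c₀, hc₀⟩ := exists_isElemCircuit_ringStarRel hN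
  have hset : {x : ℝ | ∃ c, IsElemCircuit (ringStarRel N) c ∧
      x = circuitDelay d c / (c.length : ℝ)} = {2 / ((N : ℝ) + 1)} := by
    ext x
    constructor
    · rintro ⟨c, hc, rfl⟩
      exact hratio c hc
    · rintro rfl
      exact ⟨c₀, hc₀, (hratio c₀ hc₀).symm⟩
  rw [cycleTime, hset, csSup_singleton]

/-- **Observation 1 example.** On `2N` vertices with delay `0` inside
the first half and `1` otherwise: (i) the delay is Euclidean; (ii) every Hamiltonian
cycle has total delay at least `N`, hence cycle time at least `1/2`; (iii) the overlay
`ringStarRel N` is strongly connected with cycle time exactly `2/(N+1)`. Consequently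
every Hamiltonian cycle has cycle time at least `(N+1)/4` times the optimal cycle time
over strongly connected spanning subdigraphs. -/
theorem ring_omega_N_example (N : ℕ) (hN : 2 ≤ N)
    (d : Fin (2 * N) → Fin (2 * N) → ℝ)
    (hd : ∀ i j : Fin (2 * N), d i j = if i.val < N ∧ j.val < N then 0 else 1) :
    ((∀ i j : Fin (2 * N), d i j = d j i) ∧
      (∀ i j k : Fin (2 * N), i ≠ j → i ≠ k → j ≠ k → d i j ≤ d i k + d k j)) ∧
    (∀ c : List (Fin (2 * N)), c.Nodup → (∀ v, v ∈ c) →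
      (N : ℝ) ≤ circuitDelay d c ∧ (1 / 2 : ℝ) ≤ circuitDelay d c / (2 * N : ℝ)) ∧
    (StronglyConnected (ringStarRel N) ∧
      cycleTime (ringStarRel N) d = 2 / ((N : ℝ) + 1)) ∧
    (∀ c : List (Fin (2 * N)), c.Nodup → (∀ v, v ∈ c) →
      ((N : ℝ) + 1) / 4 *
          sInf {x : ℝ | ∃ A : Fin (2 * N) → Fin (2 * N) → Prop,
            (∀ i j, A i j → i ≠ j) ∧ StronglyConnected A ∧ x = cycleTime A d} ≤
        circuitDelay d c / (2 * N : ℝ)) := by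
  have hNpos : (0 : ℝ) < N := by exact_mod_cast (by omega : 0 < N)
  have hnonneg : ∀ i j, 0 ≤ d i j := by
    intro i j
    rw [hd]
    split_ifs <;> norm_num
  have hham : ∀ c : List (Fin (2 * N)), c.Nodup → (∀ v, v ∈ c) →
      (N : ℝ) ≤ circuitDelay d c ∧ (1 / 2 : ℝ) ≤ circuitDelay d c / (2 * N : ℝ) := by
    intro c hc hmem
    have hle : (N : ℝ) ≤ circuitDelay d c := by
      rw [← sum_second_half_indicator N]
      refine sum_le_circuitDelay _ (fun i j => ?_) hc hmem
      by_cases hi : i.val < N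
      · simpa [hi] using hnonneg i j
      · simp [hd, hi]
    refine ⟨hle, ?_⟩
    rw [le_div_iff₀ (by positivity)]
    linarith
  refine ⟨⟨fun i j => ?_, fun i j k _ _ _ => ?_⟩, hham,
    ⟨stronglyConnected_ringStarRel hN, cycleTime_ringStarRel hN hd⟩, fun c hc hmem => ?_⟩
  · simp only [hd, and_comm]
  · by_cases hi : i.val < N <;> by_cases hj : j.val < N <;> by_cases hk : k.val < N <;>
      simp [hd, hi, hj, hk]
  · refine le_trans ?_ (hham c hc hmem).2
    have hinf : sInf {x : ℝ | ∃ A : Fin (2 * N) → Fin (2 * N) → Prop,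
        (∀ i j, A i j → i ≠ j) ∧ StronglyConnected A ∧ x = cycleTime A d} ≤
        2 / ((N : ℝ) + 1) := by
      refine csInf_le ⟨0, ?_⟩ ⟨ringStarRel N, fun _ _ => ringStarRel_ne hN,
        stronglyConnected_ringStarRel hN, (cycleTime_ringStarRel hN hd).symm⟩
      rintro x ⟨A, -, -, rfl⟩
      exact cycleTime_nonneg A hnonneg
    calc _ ≤ ((N : ℝ) + 1) / 4 * (2 / ((N : ℝ) + 1)) := by gcongr
      _ = 1 / 2 := by field_simp; norm_num
end
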